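/- arXiv:2007.05730 — 13 statements merged into one kernel-verified Lean document; each statement's English description precedes it below -/
import Mathlib

section
/- Let (S,+,·) be a left inverse semi-brace and let r_S be the map associated to S. Suppose that for all a,b,c ∈ S the following hold: (1) (a+b)·(a+b)⁻¹·(a+b·c) = a+b·c; (2) λ_a(b)⁻¹ + λ_{ρ_b(a)}(c) = λ_a(b)⁻¹ + λ_{(a⁻¹+b)⁻¹}(λ_b(c)); (3) ρ_b(a)⁻¹ + c = (b⁻¹+c)·(ρ_{λ_b(c)}(a)⁻¹ + ρ_c(b)). Then r_S is a set-theoretical solution of the Yang-Baxter equation. -/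
/-- An inverse semigroup: a semigroup in which every element `a` has a unique
element `inv a` satisfying `a * inv a * a = a` and `inv a * a * inv a = inv a`. -/
structure InvSemigroup (S : Type*) where
  mul : S → S → S
  inv : S → S
  mul_assoc : ∀ a b c : S, mul (mul a b) c = mul a (mul b c)
  mul_inv_mul : ∀ a : S, mul (mul a (inv a)) a = a
  inv_mul_inv : ∀ a : S, mul (mul (inv a) a) (inv a) = inv a
  inv_unique : ∀ a x : S, mul (mul a x) a = a → mul (mul x a) x = x → x = inv a

/-- A left inverse semi-brace: `(S,+)` a semigroup, `(S,·)` an inverse semigroup,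
with `a·(b+c) = a·b + a·(a⁻¹+c)`. -/
structure LeftInvSemiBrace (S : Type*) extends InvSemigroup S where
  add : S → S → S
  add_assoc : ∀ a b c : S, add (add a b) c = add a (add b c)
  brace : ∀ a b c : S, mul a (add b c) = add (mul a b) (mul a (add (inv a) c))

/-- `λ_a(b) = a·(a⁻¹+b)`. -/
def LeftInvSemiBrace.lam {S : Type*} (B : LeftInvSemiBrace S) (a b : S) : S :=
  B.mul a (B.add (B.inv a) b)

/-- `ρ_b(a) = (a⁻¹+b)⁻¹·b`. -/
def LeftInvSemiBrace.rho {S : Type*} (B : LeftInvSemiBrace S) (b a : S) : S :=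
  B.mul (B.inv (B.add (B.inv a) b)) b

/-- The map associated to a left inverse semi-brace: `r(a,b) = (λ_a(b), ρ_b(a))`. -/
def LeftInvSemiBrace.rmap {S : Type*} (B : LeftInvSemiBrace S) : S × S → S × S :=
  fun p => (B.lam p.1 p.2, B.rho p.2 p.1)

/-- `r × id` on `S × S × S`. -/
def rOne {S : Type*} (r : S × S → S × S) : S × S × S → S × S × S :=
  fun p => ((r (p.1, p.2.1)).1, (r (p.1, p.2.1)).2, p.2.2)

/-- `id × r` on `S × S × S`. -/
def rTwo {S : Type*} (r : S × S → S × S) : S × S × S → S × S × S :=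
  fun p => (p.1, r p.2)

/-- `r` is a set-theoretical solution of the Yang-Baxter equation. -/
def IsYBE {S : Type*} (r : S × S → S × S) : Prop :=
  rOne r ∘ rTwo r ∘ rOne r = rTwo r ∘ rOne r ∘ rTwo r

namespace InvSemigroup

variable {S : Type*} (G : InvSemigroup S)

instance : Std.Associative G.mul := ⟨G.mul_assoc⟩

theorem inv_inv (a : S) : G.inv (G.inv a) = a :=
  (G.inv_unique (G.inv a) a (G.inv_mul_inv a) (G.mul_inv_mul a)).symm

theorem inv_eq_self_of_idem {e : S} (he : G.mul e e = e) : G.inv e = e :=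
  (G.inv_unique e e (by rw [he, he]) (by rw [he, he])).symm

theorem idem_mul_idem {e f : S} (he : G.mul e e = e) (hf : G.mul f f = f) :
    G.mul (G.mul e f) (G.mul e f) = G.mul e f := by
  have h1 := G.mul_inv_mul (G.mul e f)
  have h2 := G.inv_mul_inv (G.mul e f)
  have hx : G.mul f (G.mul (G.inv (G.mul e f)) e) = G.inv (G.mul e f) := by
    apply G.inv_unique <;> grind
  have hxx : G.mul (G.inv (G.mul e f)) (G.inv (G.mul e f)) = G.inv (G.mul e f) := by
    grind
  have hself := G.inv_eq_self_of_idem hxx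
  rw [G.inv_inv] at hself
  rwa [← hself] at hxx

theorem idem_comm {e f : S} (he : G.mul e e = e) (hf : G.mul f f = f) :
    G.mul e f = G.mul f e := by
  have h1 := G.idem_mul_idem he hf
  have h2 := G.idem_mul_idem hf he
  rw [← G.inv_eq_self_of_idem h2]
  apply G.inv_unique <;> grind

theorem mul_inv_idem (a : S) :
    G.mul (G.mul a (G.inv a)) (G.mul a (G.inv a)) = G.mul a (G.inv a) := by
  rw [← G.mul_assoc, G.mul_inv_mul]

theorem inv_mul_idem (a : S) :
    G.mul (G.mul (G.inv a) a) (G.mul (G.inv a) a) = G.mul (G.inv a) a := by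
  rw [← G.mul_assoc, G.inv_mul_inv]

theorem inv_mul (a b : S) : G.inv (G.mul a b) = G.mul (G.inv b) (G.inv a) := by
  have hc := G.idem_comm (G.inv_mul_idem a) (G.mul_inv_idem b)
  have ha := G.mul_inv_mul a
  have hb := G.mul_inv_mul b
  have ha' := G.inv_mul_inv a
  have hb' := G.inv_mul_inv b
  symm
  apply G.inv_unique <;> grind

/-- An element fixed by the range projection of `u` has its inverse fixed on the other side. -/
theorem inv_mul_proj {u w : S} (h : G.mul (G.mul u (G.inv u)) w = w) :
    G.mul (G.inv w) (G.mul u (G.inv u)) = G.inv w := by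
  conv_rhs => rw [← h, G.inv_mul, G.inv_eq_self_of_idem (G.mul_inv_idem u)]

end InvSemigroup

namespace LeftInvSemiBrace

variable {S : Type*} (B : LeftInvSemiBrace S)

/-- Left multiplication by `(a⁻¹ + b)⁻¹` distributes over `a⁻¹ + x`, with the first
summand becoming `λ_a(b)⁻¹`. -/
theorem inv_mul_inv_add (a b x : S) :
    B.mul (B.inv (B.add (B.inv a) b)) (B.add (B.inv a) x) =
      B.add (B.inv (B.lam a b)) (B.lam (B.inv (B.add (B.inv a) b)) x) := by
  rw [B.brace, lam, lam, B.inv_mul]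

end LeftInvSemiBrace

/-- Theorem 2 (sufficient conditions for the map associated to a left inverse
semi-brace to be a solution of the Yang-Baxter equation). -/
theorem stmt_0 {S : Type*} (B : LeftInvSemiBrace S)
    (h1 : ∀ a b c : S,
      B.mul (B.mul (B.add a b) (B.inv (B.add a b))) (B.add a (B.mul b c)) =
        B.add a (B.mul b c))
    (h2 : ∀ a b c : S,
      B.add (B.inv (B.lam a b)) (B.lam (B.rho b a) c) =
        B.add (B.inv (B.lam a b)) (B.lam (B.inv (B.add (B.inv a) b)) (B.lam b c)))
    (h3 : ∀ a b c : S,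
      B.add (B.inv (B.rho b a)) c =
        B.mul (B.add (B.inv b) c)
          (B.add (B.inv (B.rho (B.lam b c) a)) (B.rho c b))) :
    IsYBE B.rmap := by
  have hproj : ∀ a b c : S,
      B.mul (B.mul (B.add (B.inv a) b) (B.inv (B.add (B.inv a) b)))
        (B.add (B.inv a) (B.lam b c)) = B.add (B.inv a) (B.lam b c) :=
    fun a b c => h1 (B.inv a) b (B.add (B.inv b) c)
  have hsum : ∀ a b c : S,
      B.add (B.inv (B.lam a b)) (B.lam (B.rho b a) c) =
        B.mul (B.inv (B.add (B.inv a) b)) (B.add (B.inv a) (B.lam b c)) :=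
    fun a b c => by rw [h2, B.inv_mul_inv_add]
  have hleft : ∀ a b c : S,
      B.lam (B.lam a b) (B.lam (B.rho b a) c) = B.lam a (B.lam b c) := by
    intro a b c
    rw [LeftInvSemiBrace.lam, hsum, LeftInvSemiBrace.lam, B.mul_assoc,
      ← B.mul_assoc _ _ (B.add _ _), hproj, ← LeftInvSemiBrace.lam]
  have hmid : ∀ a b c : S,
      B.rho (B.lam (B.rho b a) c) (B.lam a b) =
        B.lam (B.rho (B.lam b c) a) (B.rho c b) := by
    intro a b c
    have hw := B.inv_mul_proj (hproj a b c)
    calc B.rho (B.lam (B.rho b a) c) (B.lam a b)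
        = B.mul (B.mul (B.inv (B.add (B.inv a) (B.lam b c))) (B.add (B.inv a) b))
            (B.mul (B.mul (B.inv (B.add (B.inv a) b)) b) (B.add (B.inv (B.rho b a)) c)) := by
          rw [LeftInvSemiBrace.rho, hsum, B.inv_mul, B.inv_inv]; rfl
      _ = B.mul (B.mul (B.inv (B.add (B.inv a) (B.lam b c)))
            (B.mul (B.add (B.inv a) b) (B.inv (B.add (B.inv a) b))))
            (B.mul (B.lam b c)
              (B.add (B.inv (B.rho (B.lam b c) a)) (B.rho c b))) := by
          rw [h3]; simp only [LeftInvSemiBrace.lam, B.mul_assoc]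
      _ = B.lam (B.rho (B.lam b c) a) (B.rho c b) := by
          rw [hw, ← B.mul_assoc]; rfl
  have hright : ∀ a b c : S,
      B.rho c (B.rho b a) = B.rho (B.rho c b) (B.rho (B.lam b c) a) := by
    intro a b c
    rw [LeftInvSemiBrace.rho, h3, B.inv_mul, B.mul_assoc]; rfl
  funext ⟨a, b, c⟩
  exact Prod.ext (hleft a b c) (Prod.ext (hmid a b c) (hright a b c))
end

section
/- Let (S,+,·) be a left semi-brace. Then the semigroup (S,+) is stationary on the right: for all a,b,c,x ∈ S, a+b = a+c implies x+b = x+c. Consequently (S,+) is a rectangular semigroup: for all a,b,x,y ∈ S, if a+x = b+x and b+x = a+y, then a+x = b+y. -/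
/-- A left semi-brace: `(S,+)` a semigroup, `(S,·)` a group,
with `a·(b+c) = a·b + a·(a⁻¹+c)`. -/
structure LeftSemiBrace (S : Type*) where
  add : S → S → S
  mul : S → S → S
  one : S
  inv : S → S
  add_assoc : ∀ a b c : S, add (add a b) c = add a (add b c)
  mul_assoc : ∀ a b c : S, mul (mul a b) c = mul a (mul b c)
  one_mul : ∀ a : S, mul one a = a
  mul_one : ∀ a : S, mul a one = a
  mul_inv : ∀ a : S, mul a (inv a) = one
  inv_mul : ∀ a : S, mul (inv a) a = one
  brace : ∀ a b c : S, mul a (add b c) = add (mul a b) (mul a (add (inv a) c))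

/-- `λ_a(b) = a·(a⁻¹+b)`. -/
def LeftSemiBrace.lam {S : Type*} (B : LeftSemiBrace S) (a b : S) : S :=
  B.mul a (B.add (B.inv a) b)

/-- `ρ_b(a) = (a⁻¹+b)⁻¹·b`. -/
def LeftSemiBrace.rho {S : Type*} (B : LeftSemiBrace S) (b a : S) : S :=
  B.mul (B.inv (B.add (B.inv a) b)) b

/-- The map associated to a left semi-brace: `r(a,b) = (λ_a(b), ρ_b(a))`. -/
def LeftSemiBrace.rmap {S : Type*} (B : LeftSemiBrace S) : S × S → S × S :=
  fun p => (B.lam p.1 p.2, B.rho p.2 p.1)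

namespace LeftSemiBrace

variable {S : Type*} (B : LeftSemiBrace S)

theorem inv_inv (a : S) : B.inv (B.inv a) = a := by
  rw [← B.mul_one (B.inv (B.inv a)), ← B.inv_mul a, ← B.mul_assoc, B.inv_mul, B.one_mul]

theorem mul_inv_rev (a b : S) : B.inv (B.mul a b) = B.mul (B.inv b) (B.inv a) := by
  have h : B.mul (B.mul a b) (B.mul (B.inv b) (B.inv a)) = B.one := by
    rw [B.mul_assoc, ← B.mul_assoc b, B.mul_inv, B.one_mul, B.mul_inv]
  rw [← B.mul_one (B.inv (B.mul a b)), ← h, ← B.mul_assoc, B.inv_mul, B.one_mul]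

theorem lam_mul (a b c : S) : B.lam (B.mul a b) c = B.lam a (B.lam b c) := by
  simp only [lam]
  rw [B.mul_inv_rev, B.mul_assoc, B.brace b, ← B.mul_assoc b, B.mul_inv, B.one_mul]

theorem add_eq_mul_lam_inv (a b : S) : B.add a b = B.mul a (B.lam (B.inv a) b) := by
  rw [lam, B.inv_inv, ← B.mul_assoc, B.mul_inv, B.one_mul]

theorem add_eq_add_of_add_eq_add {a b c : S} (x : S) (h : B.add a b = B.add a c) :
    B.add x b = B.add x c := by
  have hlam : B.lam (B.inv a) b = B.lam (B.inv a) c := by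
    simp only [lam, B.inv_inv, h]
  have hx : B.inv x = B.mul (B.mul (B.inv x) a) (B.inv a) := by
    rw [B.mul_assoc, B.mul_inv, B.mul_one]
  rw [B.add_eq_mul_lam_inv, B.add_eq_mul_lam_inv x c, hx, B.lam_mul, B.lam_mul _ _ c, hlam]

end LeftSemiBrace

/-- The additive semigroup of a left semi-brace is stationary on the right and
consequently rectangular. -/
theorem stmt_1 {S : Type*} (B : LeftSemiBrace S) :
    (∀ a b c x : S, B.add a b = B.add a c → B.add x b = B.add x c) ∧
    (∀ a b x y : S, B.add a x = B.add b x → B.add b x = B.add a y →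
      B.add a x = B.add b y) := by
  exact ⟨fun _ _ _ x h => B.add_eq_add_of_add_eq_add x h, fun _ b _ _ h₁ h₂ =>
    h₁.trans (B.add_eq_add_of_add_eq_add b (h₁.trans h₂))⟩
end

section
/- Let (S,+,·) be a left semi-brace and let E(S) be the set of idempotents of (S,+). Then: (1) E(S) is a rectangular band, i.e., E(S) is closed under + and e+f+e = e for all e,f ∈ E(S); (2) an element e ∈ S satisfies e+e = e if and only if e is a middle unit of (S,+), i.e., a+e+b = a+b for all a,b ∈ S. -/
namespace LeftSemiBrace

variable {S : Type*} (B : LeftSemiBrace S)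

theorem inv_one : B.inv B.one = B.one := by
  rw [← B.one_mul (B.inv B.one), B.mul_inv]

theorem mul_add (a b c : S) : B.mul a (B.add b c) = B.add (B.mul a b) (B.lam a c) :=
  B.brace a b c

theorem mul_inv_cancel_left (a b : S) : B.mul a (B.mul (B.inv a) b) = b := by
  rw [← B.mul_assoc, B.mul_inv, B.one_mul]

/-- The multiplicative identity is a middle unit of the additive semigroup. -/
theorem add_one_add (a b : S) : B.add a (B.add B.one b) = B.add a b := by
  have h := B.brace B.one a b
  rw [B.inv_one, B.one_mul, B.one_mul, B.one_mul] at h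
  exact h.symm

theorem lam_lam_inv (a c : S) : B.lam a (B.lam (B.inv a) c) = B.add B.one c := by
  have h := B.mul_add (B.inv a) B.one c
  rw [B.mul_one] at h
  rw [lam, ← h, B.mul_inv_cancel_left]

theorem one_add_one : B.add B.one B.one = B.one := by
  have h := B.mul_add (B.inv (B.add B.one B.one)) B.one B.one
  rw [B.inv_mul, B.mul_one, lam, B.inv_inv, B.add_assoc, B.add_one_add, B.inv_mul] at h
  calc B.add B.one B.one
      = B.add (B.add (B.inv (B.add B.one B.one)) B.one) B.one := by rw [← h]
    _ = B.one := by rw [B.add_assoc, B.add_one_add, ← h]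

theorem lam_inv_of_add_eq {a b : S} (h : B.add a b = a) : B.lam (B.inv a) b = B.one := by
  rw [lam, B.inv_inv, h, B.inv_mul]

theorem lam_one_of_add_self {e : S} (h : B.add e e = e) : B.lam e B.one = B.add B.one e := by
  rw [← B.lam_lam_inv e e, B.lam_inv_of_add_eq h]

/-- The only additive idempotent for which `1` is a two-sided additive unit is `1`. -/
theorem eq_one_of_add_self {p : S} (h : B.add p p = p) (hl : B.add B.one p = p)
    (hr : B.add p B.one = p) : p = B.one := by
  calc p = B.lam p B.one := by rw [B.lam_one_of_add_self h, hl]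
    _ = B.lam p (B.lam (B.inv p) B.one) := by rw [B.lam_inv_of_add_eq hr]
    _ = B.one := by rw [B.lam_lam_inv, B.one_add_one]

theorem one_add_add_one {e : S} (h : B.add e e = e) :
    B.add B.one (B.add e B.one) = B.one := by
  refine B.eq_one_of_add_self ?_ (B.add_one_add _ _) ?_
  · rw [B.add_assoc, B.add_assoc, B.add_one_add, B.add_one_add, ← B.add_assoc e, h]
  · rw [B.add_assoc, B.add_assoc, B.one_add_one]

theorem add_add_of_add_self {e : S} (h : B.add e e = e) (a b : S) :
    B.add (B.add a e) b = B.add a b := by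
  calc B.add (B.add a e) b = B.add a (B.add (B.add B.one (B.add e B.one)) b) := by
        simp only [B.add_assoc, B.add_one_add]
    _ = B.add a b := by rw [B.one_add_add_one h, B.add_one_add]

theorem add_lam_one (a : S) : B.add a (B.lam a B.one) = a := by
  have h := B.mul_add a B.one B.one
  rw [B.one_add_one, B.mul_one] at h
  exact h.symm

end LeftSemiBrace

/-- In a left semi-brace: the additive idempotents form a rectangular band, and an
element is an additive idempotent iff it is a middle unit of `(S,+)`. -/
theorem stmt_2 {S : Type*} (B : LeftSemiBrace S) :
    (∀ e f : S, B.add e e = e → B.add f f = f →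
      B.add (B.add e f) (B.add e f) = B.add e f ∧ B.add (B.add e f) e = e) ∧
    (∀ e : S, B.add e e = e ↔ ∀ a b : S, B.add (B.add a e) b = B.add a b) := by
  refine ⟨fun e f he hf => ⟨?_, ?_⟩, fun e => ⟨B.add_add_of_add_self, fun h => ?_⟩⟩
  · rw [← B.add_assoc, B.add_add_of_add_self hf, he]
  · rw [B.add_add_of_add_self hf, he]
  · have h' := h e (B.lam e B.one)
    rwa [B.add_assoc, B.add_lam_one] at h'
end

section
/- Let (S,+,·) be a left inverse semi-brace such that (S,+) is a left cancellative semigroup possessing a right identity 1 (a+1 = a for all a ∈ S). Then a·a⁻¹ = 1 for every a ∈ S, and consequently (S,·) is a group with identity element 1. -/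
/-- If the additive semigroup of a left inverse semi-brace is left cancellative and
has a right identity `1`, then `a·a⁻¹ = 1` for all `a`, and `(S,·)` is a group with
identity `1`. -/
theorem stmt_3 {S : Type*} (B : LeftInvSemiBrace S) (one : S)
    (hcanc : ∀ a b c : S, B.add a b = B.add a c → b = c)
    (hone : ∀ a : S, B.add a one = a) :
    (∀ a : S, B.mul a (B.inv a) = one) ∧
    (∀ a : S, B.mul (B.inv a) a = one) ∧
    (∀ a : S, B.mul one a = a) ∧
    (∀ a : S, B.mul a one = a) := by
  have mul_inv : ∀ a : S, B.mul a (B.inv a) = one := fun a => by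
    have h := B.brace a a one
    rw [hone, hone] at h
    exact hcanc (B.mul a a) _ _ (h.symm.trans (hone _).symm)
  have inv_mul : ∀ a : S, B.mul (B.inv a) a = one := fun a => by
    have h := mul_inv (B.inv a)
    rwa [← B.inv_unique (B.inv a) a (B.inv_mul_inv a) (B.mul_inv_mul a)] at h
  refine ⟨mul_inv, inv_mul, fun a => ?_, fun a => ?_⟩
  · rw [← mul_inv a, B.mul_inv_mul]
  · rw [← inv_mul a, ← B.mul_assoc, B.mul_inv_mul]
end

section
/- Let (S,T,α,β) be a matched product system of left inverse semi-braces. Then for every a ∈ S and u ∈ T: (α_u⁻¹(a))⁻¹ = α_{β_a⁻¹(u)}⁻¹(a⁻¹) and (β_a⁻¹(u))⁻¹ = β_{α_u⁻¹(a)}⁻¹(u⁻¹), where x⁻¹ denotes the inverse of an element in (S,·) or (T,·) and α_u⁻¹, β_a⁻¹ denote the inverse bijections of α_u, β_a. -/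
/-- A matched product system of left inverse semi-braces. -/
structure MatchedSystem {S T : Type*} (BS : LeftInvSemiBrace S) (BT : LeftInvSemiBrace T) where
  α : T → S → S
  α' : T → S → S
  β : S → T → T
  β' : S → T → T
  α_left : ∀ (u : T) (a : S), α' u (α u a) = a
  α_right : ∀ (u : T) (a : S), α u (α' u a) = a
  β_left : ∀ (a : S) (u : T), β' a (β a u) = u
  β_right : ∀ (a : S) (u : T), β a (β' a u) = u
  α_add : ∀ (u : T) (a b : S), α u (BS.add a b) = BS.add (α u a) (α u b)
  β_add : ∀ (a : S) (u v : T), β a (BT.add u v) = BT.add (β a u) (β a v)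
  α_hom : ∀ (u v : T) (a : S), α (BT.mul u v) a = α u (α v a)
  β_hom : ∀ (a b : S) (u : T), β (BS.mul a b) u = β a (β b u)
  mps1 : ∀ (a b : S) (u : T), α u (BS.mul (α' u a) b) = BS.mul a (α (β' a u) b)
  mps2 : ∀ (a : S) (u v : T), β a (BT.mul (β' a u) v) = BT.mul u (β (α' u a) v)
  mps_idem : ∀ (a : S) (u : T), α u (BS.mul (α' u a) a) = a →
    β a (BT.mul (β' a u) u) = u → α u a = a ∧ β a u = u

namespace MatchedSystem

variable {S T : Type*} {BS : LeftInvSemiBrace S} {BT : LeftInvSemiBrace T}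

/-- The matched product system with the roles of the two semi-braces exchanged. -/
def swap (M : MatchedSystem BS BT) : MatchedSystem BT BS where
  α := M.β
  α' := M.β'
  β := M.α
  β' := M.α'
  α_left := M.β_left
  α_right := M.β_right
  β_left := M.α_left
  β_right := M.α_right
  α_add := M.β_add
  β_add := M.α_add
  α_hom := M.β_hom
  β_hom := M.α_hom
  mps1 := fun u v a => M.mps2 a u v
  mps2 := fun u a b => M.mps1 a b u
  mps_idem := fun u a h k => (M.mps_idem a u k h).symm

theorem α_injective (M : MatchedSystem BS BT) (u : T) : Function.Injective (M.α u) :=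
  Function.LeftInverse.injective (M.α_left u)

theorem β_injective (M : MatchedSystem BS BT) (a : S) : Function.Injective (M.β a) :=
  Function.LeftInverse.injective (M.β_left a)

theorem β_inv_apply_β (M : MatchedSystem BS BT) (a : S) (u : T) :
    M.β (BS.inv a) (M.β a u) = u := by
  apply M.β_injective a
  rw [← M.β_hom, ← M.β_hom, BS.mul_inv_mul]

theorem β'_inv (M : MatchedSystem BS BT) (a : S) (u : T) :
    M.β' (BS.inv a) u = M.β a u := by
  conv_lhs => rw [← M.β_inv_apply_β a u]
  exact M.β_left _ _

theorem inv_α' (M : MatchedSystem BS BT) (a : S) (u : T) :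
    BS.inv (M.α' u a) = M.α' (M.β' a u) (BS.inv a) := by
  have key (b : S) : M.α (M.β' a u) (BS.mul (M.α' (M.β' a u) (BS.inv a)) b) =
      BS.mul (BS.inv a) (M.α u b) := by
    rw [M.mps1, M.β'_inv, M.β_right]
  symm
  apply BS.inv_unique
  · apply M.α_injective u
    rw [BS.mul_assoc, M.mps1, key, M.α_right, ← BS.mul_assoc, BS.mul_inv_mul]
  · apply M.α_injective (M.β' a u)
    rw [BS.mul_assoc, key, M.mps1, M.α_right, ← BS.mul_assoc, BS.inv_mul_inv]

end MatchedSystem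

/-- Lemma on inverses in a matched product system of left inverse semi-braces. -/
theorem stmt_4 {S T : Type*} {BS : LeftInvSemiBrace S} {BT : LeftInvSemiBrace T}
    (M : MatchedSystem BS BT) :
    ∀ (a : S) (u : T),
      BS.inv (M.α' u a) = M.α' (M.β' a u) (BS.inv a) ∧
      BT.inv (M.β' a u) = M.β' (M.α' u a) (BT.inv u) := by
  exact fun a u => ⟨M.inv_α' a u, M.swap.inv_α' u a⟩
end

section
/- Let S and T be left inverse semi-braces and σ a homomorphism from (T,·) into the automorphism group of the left inverse semi-brace S; write ^u a := σ_u(a). Then S×T, equipped with (a,u)+(b,v) = (a+b, u+v) and (a,u)·(b,v) = (a·(^u b), u·v), is a left inverse semi-brace (the semidirect product S⋊_σ T). -/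
/-- An action of an inverse semigroup by injective maps sends `u⁻¹` to a left inverse of the
action of `u`. -/
theorem InvSemigroup.act_inv_act {S T : Type*} (M : InvSemigroup T) (σ : T → S → S)
    (hinj : ∀ u : T, Function.Injective (σ u))
    (hσ : ∀ (u v : T) (a : S), σ (M.mul u v) a = σ u (σ v a)) (u : T) (a : S) :
    σ (M.inv u) (σ u a) = a := by
  apply hinj u
  rw [← hσ, ← hσ, M.mul_inv_mul]

/-- An action of an inverse semigroup by injective maps sends `u⁻¹` to a right inverse of the
action of `u`. -/
theorem InvSemigroup.act_act_inv {S T : Type*} (M : InvSemigroup T) (σ : T → S → S)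
    (hinj : ∀ u : T, Function.Injective (σ u))
    (hσ : ∀ (u v : T) (a : S), σ (M.mul u v) a = σ u (σ v a)) (u : T) (a : S) :
    σ u (σ (M.inv u) a) = a := by
  apply hinj (M.inv u)
  rw [← hσ, ← hσ, M.inv_mul_inv]

/-- The semidirect product of two left inverse semi-braces via a homomorphism
`σ : (T,·) → Aut(S)` is a left inverse semi-brace. -/
theorem stmt_7 {S T : Type*} (BS : LeftInvSemiBrace S) (BT : LeftInvSemiBrace T)
    (σ : T → S → S)
    (hbij : ∀ u : T, Function.Bijective (σ u))
    (hσadd : ∀ (u : T) (a b : S), σ u (BS.add a b) = BS.add (σ u a) (σ u b))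
    (hσmul : ∀ (u : T) (a b : S), σ u (BS.mul a b) = BS.mul (σ u a) (σ u b))
    (hσhom : ∀ (u v : T) (a : S), σ (BT.mul u v) a = σ u (σ v a)) :
    ∃ B : LeftInvSemiBrace (S × T),
      (∀ p q : S × T, B.add p q = (BS.add p.1 q.1, BT.add p.2 q.2)) ∧
      (∀ p q : S × T, B.mul p q = (BS.mul p.1 (σ p.2 q.1), BT.mul p.2 q.2)) := by
  have hl := BT.act_inv_act σ (fun u => (hbij u).injective) hσhom
  have hr := BT.act_act_inv σ (fun u => (hbij u).injective) hσhom
  refine ⟨{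
    mul := fun p q => (BS.mul p.1 (σ p.2 q.1), BT.mul p.2 q.2)
    inv := fun p => (σ (BT.inv p.2) (BS.inv p.1), BT.inv p.2)
    add := fun p q => (BS.add p.1 q.1, BT.add p.2 q.2)
    mul_assoc := ?_
    mul_inv_mul := ?_
    inv_mul_inv := ?_
    inv_unique := ?_
    add_assoc := ?_
    brace := ?_ }, fun _ _ => rfl, fun _ _ => rfl⟩
  · rintro ⟨a, u⟩ ⟨b, v⟩ ⟨c, w⟩
    simp only [hσmul, hσhom, BS.mul_assoc, BT.mul_assoc]
  · rintro ⟨a, u⟩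
    simp only [hσhom, hr, BS.mul_inv_mul, BT.mul_inv_mul]
  · rintro ⟨a, u⟩
    simp only [hσhom, hl, ← hσmul, BS.inv_mul_inv, BT.inv_mul_inv]
  · rintro ⟨a, u⟩ ⟨x, v⟩ h₁ h₂
    simp only [Prod.mk.injEq] at h₁ h₂ ⊢
    obtain rfl := BT.inv_unique u v h₁.2 h₂.2
    refine ⟨?_, rfl⟩
    rw [hσhom, hr] at h₁
    rw [hσhom, hl] at h₂
    have h₃ := congrArg (σ u) h₂.1
    rw [hσmul, hσmul, hr] at h₃
    rw [← BS.inv_unique a (σ u x) h₁.1 h₃, hl]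
  · rintro ⟨a, u⟩ ⟨b, v⟩ ⟨c, w⟩
    simp only [BS.add_assoc, BT.add_assoc]
  · rintro ⟨a, u⟩ ⟨b, v⟩ ⟨c, w⟩
    simp only [hσadd, hr]
    rw [BS.brace a, BT.brace u]
end

section
/- Let S and T be left inverse semi-braces whose associated maps r_S and r_T are set-theoretical solutions of the Yang-Baxter equation, and let σ be a homomorphism from (T,·) into the automorphism group of the left inverse semi-brace S; write ^u a := σ_u(a). Then the map r_B associated to the semidirect product B = S⋊_σ T is a set-theoretical solution of the Yang-Baxter equation, and it is given by r_B((a,u),(b,v)) = ((^u(λ_{^{u⁻¹}a}(b)), λ_u(v)), (^{λ_u(v)⁻¹}(ρ_{^u b}(a)), ρ_v(u))). -/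
/-- `σ` is an action of `(T,·)` on the left inverse semi-brace `S` by automorphisms. -/
structure LeftInvSemiBrace.IsAction {S T : Type*} (BS : LeftInvSemiBrace S)
    (BT : LeftInvSemiBrace T) (σ : T → S → S) : Prop where
  bijective : ∀ u : T, Function.Bijective (σ u)
  map_add : ∀ (u : T) (a b : S), σ u (BS.add a b) = BS.add (σ u a) (σ u b)
  map_mul : ∀ (u : T) (a b : S), σ u (BS.mul a b) = BS.mul (σ u a) (σ u b)
  mul_apply : ∀ (u v : T) (a : S), σ (BT.mul u v) a = σ u (σ v a)

namespace LeftInvSemiBrace.IsAction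

variable {S T : Type*} {BS : LeftInvSemiBrace S} {BT : LeftInvSemiBrace T} {σ : T → S → S}

theorem inv_apply_self (h : BS.IsAction BT σ) (u : T) (a : S) : σ (BT.inv u) (σ u a) = a := by
  apply (h.bijective u).1
  rw [← h.mul_apply, ← h.mul_apply, BT.mul_inv_mul]

theorem apply_inv_self (h : BS.IsAction BT σ) (u : T) (a : S) : σ u (σ (BT.inv u) a) = a := by
  obtain ⟨b, rfl⟩ := (h.bijective u).2 a
  rw [h.inv_apply_self]

theorem map_inv (h : BS.IsAction BT σ) (u : T) (a : S) : σ u (BS.inv a) = BS.inv (σ u a) := by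
  apply BS.inv_unique
  · rw [← h.map_mul, ← h.map_mul, BS.mul_inv_mul]
  · rw [← h.map_mul, ← h.map_mul, BS.inv_mul_inv]

theorem map_lam (h : BS.IsAction BT σ) (u : T) (a b : S) :
    σ u (BS.lam a b) = BS.lam (σ u a) (σ u b) := by
  simp only [lam, h.map_mul, h.map_add, h.map_inv]

theorem map_rho (h : BS.IsAction BT σ) (u : T) (a b : S) :
    σ u (BS.rho a b) = BS.rho (σ u a) (σ u b) := by
  simp only [rho, h.map_mul, h.map_add, h.map_inv]

theorem inv_mul_apply (h : BS.IsAction BT σ) (u v : T) (a : S) :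
    σ (BT.inv (BT.mul u v)) a = σ (BT.inv v) (σ (BT.inv u) a) := by
  apply (h.bijective (BT.mul u v)).1
  rw [h.apply_inv_self, h.mul_apply, h.apply_inv_self, h.apply_inv_self]

theorem lam_rho_apply (h : BS.IsAction BT σ) (u v : T) (a : S) :
    σ (BT.lam u v) (σ (BT.rho v u) a) = σ u (σ v a) := by
  simp only [lam, rho, h.mul_apply, h.apply_inv_self]

variable {B : LeftInvSemiBrace (S × T)}

theorem semidirect_inv (h : BS.IsAction BT σ)
    (hmul : ∀ p q : S × T, B.mul p q = (BS.mul p.1 (σ p.2 q.1), BT.mul p.2 q.2)) (p : S × T) :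
    B.inv p = (σ (BT.inv p.2) (BS.inv p.1), BT.inv p.2) := by
  symm
  apply B.inv_unique
  · simp only [hmul, h.mul_apply, h.apply_inv_self, BS.mul_inv_mul, BT.mul_inv_mul]
  · simp only [hmul, h.mul_apply, h.apply_inv_self, ← h.map_mul,
      BS.inv_mul_inv, BT.inv_mul_inv]

theorem semidirect_rmap (h : BS.IsAction BT σ)
    (hadd : ∀ p q : S × T, B.add p q = (BS.add p.1 q.1, BT.add p.2 q.2))
    (hmul : ∀ p q : S × T, B.mul p q = (BS.mul p.1 (σ p.2 q.1), BT.mul p.2 q.2))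
    (a b : S) (u v : T) :
    B.rmap ((a, u), (b, v)) =
      ((BS.lam a (σ u b), BT.lam u v),
       (σ (BT.inv (BT.lam u v)) (BS.rho (σ u b) a), BT.rho v u)) := by
  simp only [rmap, lam, rho, hmul, hadd, h.semidirect_inv hmul, h.map_mul, h.map_add,
    h.map_inv, h.inv_mul_apply, h.inv_apply_self, h.apply_inv_self]

/-- The coordinates on `(S × T)³` in which the map associated to the semidirect product
becomes the product of the maps associated to the factors. -/
def untwist (σ : T → S → S) (x : (S × T) × (S × T) × (S × T)) : (S × S × S) × (T × T × T) :=
  ((x.1.1, σ x.1.2 x.2.1.1, σ x.1.2 (σ x.2.1.2 x.2.2.1)), (x.1.2, x.2.1.2, x.2.2.2))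

theorem untwist_injective (h : BS.IsAction BT σ) : Function.Injective (untwist σ) := by
  rintro ⟨⟨a, u⟩, ⟨b, v⟩, ⟨c, w⟩⟩ ⟨⟨a', u'⟩, ⟨b', v'⟩, ⟨c', w'⟩⟩ hxy
  simp only [untwist, Prod.mk.injEq] at hxy
  obtain ⟨⟨rfl, hb, hc⟩, rfl, rfl, rfl⟩ := hxy
  obtain rfl := (h.bijective _).1 hb
  obtain rfl := (h.bijective _).1 ((h.bijective _).1 hc)
  rfl

theorem untwist_rOne (h : BS.IsAction BT σ)
    (hadd : ∀ p q : S × T, B.add p q = (BS.add p.1 q.1, BT.add p.2 q.2))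
    (hmul : ∀ p q : S × T, B.mul p q = (BS.mul p.1 (σ p.2 q.1), BT.mul p.2 q.2))
    (x : (S × T) × (S × T) × (S × T)) :
    untwist σ (rOne B.rmap x) =
      (rOne BS.rmap (untwist σ x).1, rOne BT.rmap (untwist σ x).2) := by
  obtain ⟨⟨a, u⟩, ⟨b, v⟩, ⟨c, w⟩⟩ := x
  simp only [untwist, rOne, h.semidirect_rmap hadd hmul, h.apply_inv_self, h.lam_rho_apply]
  rfl

theorem untwist_rTwo (h : BS.IsAction BT σ)
    (hadd : ∀ p q : S × T, B.add p q = (BS.add p.1 q.1, BT.add p.2 q.2))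
    (hmul : ∀ p q : S × T, B.mul p q = (BS.mul p.1 (σ p.2 q.1), BT.mul p.2 q.2))
    (x : (S × T) × (S × T) × (S × T)) :
    untwist σ (rTwo B.rmap x) =
      (rTwo BS.rmap (untwist σ x).1, rTwo BT.rmap (untwist σ x).2) := by
  obtain ⟨⟨a, u⟩, ⟨b, v⟩, ⟨c, w⟩⟩ := x
  simp only [untwist, rTwo, h.semidirect_rmap hadd hmul, h.apply_inv_self, h.map_lam, h.map_rho]
  rfl

end LeftInvSemiBrace.IsAction

/-- The map associated to the semidirect product of two left inverse semi-braces
having solutions is a solution, and it is given by the indicated formula. -/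
theorem stmt_8 {S T : Type*} (BS : LeftInvSemiBrace S) (BT : LeftInvSemiBrace T)
    (σ : T → S → S)
    (hbij : ∀ u : T, Function.Bijective (σ u))
    (hσadd : ∀ (u : T) (a b : S), σ u (BS.add a b) = BS.add (σ u a) (σ u b))
    (hσmul : ∀ (u : T) (a b : S), σ u (BS.mul a b) = BS.mul (σ u a) (σ u b))
    (hσhom : ∀ (u v : T) (a : S), σ (BT.mul u v) a = σ u (σ v a))
    (hS : IsYBE BS.rmap) (hT : IsYBE BT.rmap)
    (B : LeftInvSemiBrace (S × T))
    (hadd : ∀ p q : S × T, B.add p q = (BS.add p.1 q.1, BT.add p.2 q.2))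
    (hmul : ∀ p q : S × T, B.mul p q = (BS.mul p.1 (σ p.2 q.1), BT.mul p.2 q.2)) :
    IsYBE B.rmap ∧
    ∀ (a b : S) (u v : T),
      B.rmap ((a, u), (b, v)) =
        ((σ u (BS.lam (σ (BT.inv u) a) b), BT.lam u v),
         (σ (BT.inv (BT.lam u v)) (BS.rho (σ u b) a), BT.rho v u)) := by
  have h : BS.IsAction BT σ := ⟨hbij, hσadd, hσmul, hσhom⟩
  refine ⟨funext fun x => h.untwist_injective ?_, fun a b u v => ?_⟩
  · simp only [Function.comp_apply, h.untwist_rOne hadd hmul, h.untwist_rTwo hadd hmul]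
    exact Prod.ext (congrFun hS _) (congrFun hT _)
  · rw [h.semidirect_rmap hadd hmul, h.map_lam, h.apply_inv_self]
end

section
/- Let S and T be left inverse semi-braces, σ a homomorphism from (T,·) into the automorphism group of the left inverse semi-brace S (write ^u a := σ_u(a)), and δ a map assigning to each a ∈ S an additive endomorphism of (T,+) (write u^a := δ(a)(u)) which is an anti-homomorphism from (S,+), i.e., u^{a+b} = (u^a)^b for all a,b ∈ S, u ∈ T. Suppose that (u·v)^{λ_a(^u b)} + u·((u⁻¹)^c + w) = u·(v^c + w) for all a,b,c ∈ S and u,v,w ∈ T, applied with arbitrary arguments as in: (u·v)^{λ_a(^u b)} + u·((u⁻¹)^b + w) = u·(v^b + w) for all a,b ∈ S and u,v,w ∈ T. Then S×T, equipped with (a,u)+(b,v) = (a+b, u^b+v) and (a,u)·(b,v) = (a·(^u b), u·v), is a left inverse semi-brace (the double semidirect product of S and T via σ and δ). -/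
/-- The double semidirect product of two left inverse semi-braces via `σ` and `δ`
is a left inverse semi-brace. -/
theorem stmt_10 {S T : Type*} (BS : LeftInvSemiBrace S) (BT : LeftInvSemiBrace T)
    (σ : T → S → S)
    (hbij : ∀ u : T, Function.Bijective (σ u))
    (hσadd : ∀ (u : T) (a b : S), σ u (BS.add a b) = BS.add (σ u a) (σ u b))
    (hσmul : ∀ (u : T) (a b : S), σ u (BS.mul a b) = BS.mul (σ u a) (σ u b))
    (hσhom : ∀ (u v : T) (a : S), σ (BT.mul u v) a = σ u (σ v a))
    (δ : S → T → T)
    (hδadd : ∀ (a : S) (u v : T), δ a (BT.add u v) = BT.add (δ a u) (δ a v))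
    (hδanti : ∀ (a b : S) (u : T), δ (BS.add a b) u = δ b (δ a u))
    (hcomp : ∀ (a b : S) (u v w : T),
      BT.add (δ (BS.lam a (σ u b)) (BT.mul u v))
          (BT.mul u (BT.add (δ b (BT.inv u)) w)) =
        BT.mul u (BT.add (δ b v) w)) :
    ∃ B : LeftInvSemiBrace (S × T),
      (∀ p q : S × T, B.add p q = (BS.add p.1 q.1, BT.add (δ q.1 p.2) q.2)) ∧
      (∀ p q : S × T, B.mul p q = (BS.mul p.1 (σ p.2 q.1), BT.mul p.2 q.2)) := by
  have hidem : ∀ e : T, BT.mul e e = e → ∀ x, σ e x = x := fun e he x =>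
    (hbij e).1 (by rw [← hσhom, he])
  have hinv₁ : ∀ u x, σ (BT.mul u (BT.inv u)) x = x := fun u =>
    hidem _ (by rw [← BT.mul_assoc, BT.mul_inv_mul])
  have hinv₂ : ∀ u x, σ (BT.mul (BT.inv u) u) x = x := fun u =>
    hidem _ (by rw [← BT.mul_assoc, BT.inv_mul_inv])
  have hcancel : ∀ u x, σ u (σ (BT.inv u) x) = x := fun u x => by rw [← hσhom, hinv₁]
  refine ⟨{
    mul := fun p q => (BS.mul p.1 (σ p.2 q.1), BT.mul p.2 q.2)
    inv := fun p => (σ (BT.inv p.2) (BS.inv p.1), BT.inv p.2)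
    add := fun p q => (BS.add p.1 q.1, BT.add (δ q.1 p.2) q.2)
    mul_assoc := ?_
    mul_inv_mul := ?_
    inv_mul_inv := ?_
    inv_unique := ?_
    add_assoc := ?_
    brace := ?_ }, fun _ _ => rfl, fun _ _ => rfl⟩
  · rintro ⟨a, u⟩ ⟨b, v⟩ ⟨c, w⟩
    simp only [hσmul, hσhom, BS.mul_assoc, BT.mul_assoc]
  · rintro ⟨a, u⟩
    simp only [hcancel, hinv₁, BS.mul_inv_mul, BT.mul_inv_mul]
  · rintro ⟨a, u⟩
    simp only [hinv₂, ← hσmul, BS.inv_mul_inv, BT.inv_mul_inv]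
  · rintro ⟨a, u⟩ ⟨x, y⟩ h₁ h₂
    simp only [Prod.mk.injEq] at h₁ h₂ ⊢
    obtain rfl : y = BT.inv u := BT.inv_unique u y h₁.2 h₂.2
    refine ⟨?_, rfl⟩
    have hx₁ := h₁.1
    rw [hinv₁] at hx₁
    have hx₂ := congrArg (σ u) h₂.1
    rw [hinv₂, hσmul, hσmul, hcancel] at hx₂
    apply (hbij u).1
    rw [hcancel]
    exact BS.inv_unique a _ hx₁ hx₂
  · rintro ⟨a, u⟩ ⟨b, v⟩ ⟨c, w⟩
    simp only [hδadd, hδanti, BS.add_assoc, BT.add_assoc]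
  · rintro ⟨a, u⟩ ⟨b, v⟩ ⟨c, w⟩
    simp only [hσadd, hcancel, Prod.mk.injEq]
    exact ⟨BS.brace _ _ _, (hcomp a c u v w).symm⟩
end

section
/- Let S and T be left inverse semi-braces and B the double semidirect product of S and T via σ and δ (so B = S×T with (a,u)+(b,v) = (a+b, u^b+v) and (a,u)·(b,v) = (a·(^u b), u·v)). Then the map r_B associated to B satisfies, for all (a,u),(b,v) ∈ S×T: λ_{(a,u)}(b,v) = (λ_a(^u b), u·((u⁻¹)^b + v)) and ρ_{(b,v)}(a,u) = (^{((u⁻¹)^b + v)⁻¹·u⁻¹}(ρ_{^u b}(a)), ((u⁻¹)^b + v)⁻¹·v). -/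
theorem action_inv_cancel {S T : Type*} (G : InvSemigroup T) {σ : T → S → S}
    (hbij : ∀ u, Function.Bijective (σ u))
    (hhom : ∀ u v a, σ (G.mul u v) a = σ u (σ v a)) (u : T) (a : S) :
    σ u (σ (G.inv u) a) = a := by
  obtain ⟨c, rfl⟩ := (hbij u).2 a
  rw [← hhom, ← hhom, G.mul_inv_mul]

theorem action_inv_cancel_left {S T : Type*} (G : InvSemigroup T) {σ : T → S → S}
    (hbij : ∀ u, Function.Bijective (σ u))
    (hhom : ∀ u v a, σ (G.mul u v) a = σ u (σ v a)) (u : T) (a : S) :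
    σ (G.inv u) (σ u a) = a :=
  (hbij u).1 (action_inv_cancel G hbij hhom u _)

theorem InvSemigroup.map_inv {S T : Type*} (G : InvSemigroup S) (H : InvSemigroup T)
    {f : S → T} (hf : ∀ a b, f (G.mul a b) = H.mul (f a) (f b)) (a : S) :
    f (G.inv a) = H.inv (f a) := by
  apply H.inv_unique
  · rw [← hf, ← hf, G.mul_inv_mul]
  · rw [← hf, ← hf, G.inv_mul_inv]

theorem InvSemigroup.inv_semidirect {S T : Type*} (G : InvSemigroup S) (H : InvSemigroup T)
    {σ : T → S → S} (hbij : ∀ u, Function.Bijective (σ u))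
    (hσmul : ∀ u a b, σ u (G.mul a b) = G.mul (σ u a) (σ u b))
    (hhom : ∀ u v a, σ (H.mul u v) a = σ u (σ v a)) (K : InvSemigroup (S × T))
    (hmul : ∀ p q : S × T, K.mul p q = (G.mul p.1 (σ p.2 q.1), H.mul p.2 q.2))
    (a : S) (u : T) :
    K.inv (a, u) = (σ (H.inv u) (G.inv a), H.inv u) := by
  symm
  apply K.inv_unique
  · simp only [hmul, hhom, action_inv_cancel H hbij hhom, G.mul_inv_mul, H.mul_inv_mul]
  · simp only [hmul, hhom, action_inv_cancel_left H hbij hhom, ← hσmul, G.inv_mul_inv,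
      H.inv_mul_inv]

/-- The map associated to the double semidirect product of two left inverse
semi-braces is given by the indicated formulas. -/
theorem stmt_11 {S T : Type*} (BS : LeftInvSemiBrace S) (BT : LeftInvSemiBrace T)
    (σ : T → S → S)
    (hbij : ∀ u : T, Function.Bijective (σ u))
    (hσadd : ∀ (u : T) (a b : S), σ u (BS.add a b) = BS.add (σ u a) (σ u b))
    (hσmul : ∀ (u : T) (a b : S), σ u (BS.mul a b) = BS.mul (σ u a) (σ u b))
    (hσhom : ∀ (u v : T) (a : S), σ (BT.mul u v) a = σ u (σ v a))
    (δ : S → T → T)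
    (hδadd : ∀ (a : S) (u v : T), δ a (BT.add u v) = BT.add (δ a u) (δ a v))
    (hδanti : ∀ (a b : S) (u : T), δ (BS.add a b) u = δ b (δ a u))
    (hcomp : ∀ (a b : S) (u v w : T),
      BT.add (δ (BS.lam a (σ u b)) (BT.mul u v))
          (BT.mul u (BT.add (δ b (BT.inv u)) w)) =
        BT.mul u (BT.add (δ b v) w))
    (B : LeftInvSemiBrace (S × T))
    (hadd : ∀ p q : S × T, B.add p q = (BS.add p.1 q.1, BT.add (δ q.1 p.2) q.2))
    (hmul : ∀ p q : S × T, B.mul p q = (BS.mul p.1 (σ p.2 q.1), BT.mul p.2 q.2)) :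
    ∀ (a b : S) (u v : T),
      B.lam (a, u) (b, v) =
        (BS.lam a (σ u b), BT.mul u (BT.add (δ b (BT.inv u)) v)) ∧
      B.rho (b, v) (a, u) =
        (σ (BT.mul (BT.inv (BT.add (δ b (BT.inv u)) v)) (BT.inv u))
            (BS.rho (σ u b) a),
         BT.mul (BT.inv (BT.add (δ b (BT.inv u)) v)) v) := by
  intro a b u v
  have hinv := BS.inv_semidirect BT.toInvSemigroup hbij hσmul hσhom B.toInvSemigroup hmul
  have hcancel := action_inv_cancel BT.toInvSemigroup hbij hσhom
  have hcancel_left := action_inv_cancel_left BT.toInvSemigroup hbij hσhom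
  have hσinv : ∀ (u : T) (a : S), σ u (BS.inv a) = BS.inv (σ u a) := fun u =>
    BS.map_inv BS.toInvSemigroup (hσmul u)
  constructor
  · simp only [LeftInvSemiBrace.lam, hinv, hadd, hmul, hσadd, hcancel]
  · simp only [LeftInvSemiBrace.rho, hinv, hadd, hmul, hσhom, hσmul, hσinv, hσadd, hcancel_left]
end

section
/- Let S and T be left semi-braces, σ a homomorphism from (T,·) into the automorphism group of the left semi-brace S (write ^u a := σ_u(a)), and δ a map assigning to each a ∈ S a bijective additive endomorphism of (T,+) (write u^a := δ(a)(u)) with u^{a+b} = (u^a)^b for all a,b ∈ S, u ∈ T, satisfying (u·v)^{λ_a(^u b)} + u·((u⁻¹)^b + w) = u·(v^b + w) for all a,b ∈ S, u,v,w ∈ T. Then the double semidirect product of S and T via σ and δ, i.e., S×T with (a,u)+(b,v) = (a+b, u^b+v) and (a,u)·(b,v) = (a·(^u b), u·v), is a left semi-brace; moreover, if (S,+) and (T,+) are left cancellative then so is (S×T,+). -/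
namespace LeftSemiBrace

variable {S T : Type*}

theorem mul_left_cancel (B : LeftSemiBrace S) {a b c : S}
    (h : B.mul a b = B.mul a c) : b = c := by
  have := congrArg (B.mul (B.inv a)) h
  rwa [← B.mul_assoc, ← B.mul_assoc, B.inv_mul, B.one_mul, B.one_mul] at this

theorem map_one_of_map_mul (B : LeftSemiBrace S) {f : S → S}
    (hf : ∀ a b : S, f (B.mul a b) = B.mul (f a) (f b)) : f B.one = B.one :=
  B.mul_left_cancel (a := f B.one) (by rw [← hf, B.one_mul, B.mul_one])

theorem action_one (B : LeftSemiBrace T) {σ : T → S → S}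
    (hinj : Function.Injective (σ B.one))
    (hσ : ∀ (u v : T) (a : S), σ (B.mul u v) a = σ u (σ v a)) (a : S) :
    σ B.one a = a :=
  hinj (by rw [← hσ, B.one_mul])

end LeftSemiBrace

/-- The double semidirect product of two left semi-braces is a left semi-brace;
moreover, if both additive semigroups are left cancellative, so is that of the
product. -/
theorem stmt_12 {S T : Type*} (BS : LeftSemiBrace S) (BT : LeftSemiBrace T)
    (σ : T → S → S)
    (hbij : ∀ u : T, Function.Bijective (σ u))
    (hσadd : ∀ (u : T) (a b : S), σ u (BS.add a b) = BS.add (σ u a) (σ u b))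
    (hσmul : ∀ (u : T) (a b : S), σ u (BS.mul a b) = BS.mul (σ u a) (σ u b))
    (hσhom : ∀ (u v : T) (a : S), σ (BT.mul u v) a = σ u (σ v a))
    (δ : S → T → T)
    (hδbij : ∀ a : S, Function.Bijective (δ a))
    (hδadd : ∀ (a : S) (u v : T), δ a (BT.add u v) = BT.add (δ a u) (δ a v))
    (hδanti : ∀ (a b : S) (u : T), δ (BS.add a b) u = δ b (δ a u))
    (hcomp : ∀ (a b : S) (u v w : T),
      BT.add (δ (BS.lam a (σ u b)) (BT.mul u v))
          (BT.mul u (BT.add (δ b (BT.inv u)) w)) =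
        BT.mul u (BT.add (δ b v) w)) :
    ∃ B : LeftSemiBrace (S × T),
      (∀ p q : S × T, B.add p q = (BS.add p.1 q.1, BT.add (δ q.1 p.2) q.2)) ∧
      (∀ p q : S × T, B.mul p q = (BS.mul p.1 (σ p.2 q.1), BT.mul p.2 q.2)) ∧
      ((∀ a b c : S, BS.add a b = BS.add a c → b = c) →
       (∀ u v w : T, BT.add u v = BT.add u w → v = w) →
       ∀ p q r : S × T, B.add p q = B.add p r → q = r) := by
  have hone : ∀ u : T, σ u BS.one = BS.one := fun u => BS.map_one_of_map_mul (hσmul u)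
  have hid : ∀ a : S, σ BT.one a = a := BT.action_one (hbij BT.one).injective hσhom
  have hinv : ∀ (u : T) (a : S), σ u (σ (BT.inv u) a) = a := fun u a => by
    rw [← hσhom, BT.mul_inv, hid]
  refine ⟨{
    add := fun p q => (BS.add p.1 q.1, BT.add (δ q.1 p.2) q.2)
    mul := fun p q => (BS.mul p.1 (σ p.2 q.1), BT.mul p.2 q.2)
    one := (BS.one, BT.one)
    inv := fun p => (σ (BT.inv p.2) (BS.inv p.1), BT.inv p.2)
    add_assoc := fun p q r => by simp only [BS.add_assoc, BT.add_assoc, hδadd, hδanti]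
    mul_assoc := fun p q r => by simp only [BS.mul_assoc, BT.mul_assoc, hσmul, hσhom]
    one_mul := fun p => by simp only [hid, BS.one_mul, BT.one_mul]
    mul_one := fun p => by simp only [hone, BS.mul_one, BT.mul_one]
    mul_inv := fun p => by simp only [hinv, BS.mul_inv, BT.mul_inv]
    inv_mul := fun p => by simp only [← hσmul, BS.inv_mul, BT.inv_mul, hone]
    brace := fun p q r => ?_ }, fun _ _ => rfl, fun _ _ => rfl, ?_⟩
  · simp only [hσadd, hinv]
    exact Prod.ext (BS.brace _ _ _) (hcomp p.1 r.1 p.2 q.2 r.2).symm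
  · rintro hS hT p ⟨b, v⟩ ⟨c, w⟩ h
    obtain ⟨h₁, h₂⟩ := Prod.mk.inj h
    obtain rfl : b = c := hS _ _ _ h₁
    exact Prod.ext rfl (hT _ _ _ h₂)
end

section
/- Let S and T be skew left braces, σ a homomorphism from (T,·) into the automorphism group of the skew left brace S (write ^u a := σ_u(a)), and δ a map assigning to each a ∈ S an automorphism of the group (T,+) (write u^a := δ(a)(u)) with u^{a+b} = (u^a)^b for all a,b ∈ S, u ∈ T, satisfying (u·v)^{λ_a(^u b)} + u·((u⁻¹)^b + w) = u·(v^b + w) for all a,b ∈ S, u,v,w ∈ T. Then the double semidirect product of S and T via σ and δ, i.e., S×T with (a,u)+(b,v) = (a+b, u^b+v) and (a,u)·(b,v) = (a·(^u b), u·v), is a skew left brace. -/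
/-- A skew left brace: `(S,+)` and `(S,·)` groups with
`a·(b+c) = a·b + a·(a⁻¹+c)`. -/
structure SkewLeftBrace (S : Type*) where
  add : S → S → S
  zero : S
  neg : S → S
  mul : S → S → S
  one : S
  inv : S → S
  add_assoc : ∀ a b c : S, add (add a b) c = add a (add b c)
  zero_add : ∀ a : S, add zero a = a
  add_zero : ∀ a : S, add a zero = a
  add_neg : ∀ a : S, add a (neg a) = zero
  neg_add : ∀ a : S, add (neg a) a = zero
  mul_assoc : ∀ a b c : S, mul (mul a b) c = mul a (mul b c)
  one_mul : ∀ a : S, mul one a = a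
  mul_one : ∀ a : S, mul a one = a
  mul_inv : ∀ a : S, mul a (inv a) = one
  inv_mul : ∀ a : S, mul (inv a) a = one
  brace : ∀ a b c : S, mul a (add b c) = add (mul a b) (mul a (add (inv a) c))

/-- `λ_a(b) = a·(a⁻¹+b)` for a skew left brace. -/
def SkewLeftBrace.lam {S : Type*} (B : SkewLeftBrace S) (a b : S) : S :=
  B.mul a (B.add (B.inv a) b)

namespace SkewLeftBrace

variable {S : Type*} (B : SkewLeftBrace S)

theorem eq_zero_of_add_self {a : S} (h : B.add a a = a) : a = B.zero := by
  rw [← B.neg_add a]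
  nth_rewrite 3 [← h]
  rw [← B.add_assoc, B.neg_add, B.zero_add]

theorem eq_one_of_mul_self {a : S} (h : B.mul a a = a) : a = B.one := by
  rw [← B.inv_mul a]
  nth_rewrite 3 [← h]
  rw [← B.mul_assoc, B.inv_mul, B.one_mul]

end SkewLeftBrace

/-- The double semidirect product of two skew left braces is a skew left brace. -/
theorem stmt_13 {S T : Type*} (BS : SkewLeftBrace S) (BT : SkewLeftBrace T)
    (σ : T → S → S)
    (hbij : ∀ u : T, Function.Bijective (σ u))
    (hσadd : ∀ (u : T) (a b : S), σ u (BS.add a b) = BS.add (σ u a) (σ u b))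
    (hσmul : ∀ (u : T) (a b : S), σ u (BS.mul a b) = BS.mul (σ u a) (σ u b))
    (hσhom : ∀ (u v : T) (a : S), σ (BT.mul u v) a = σ u (σ v a))
    (δ : S → T → T)
    (hδbij : ∀ a : S, Function.Bijective (δ a))
    (hδadd : ∀ (a : S) (u v : T), δ a (BT.add u v) = BT.add (δ a u) (δ a v))
    (hδanti : ∀ (a b : S) (u : T), δ (BS.add a b) u = δ b (δ a u))
    (hcomp : ∀ (a b : S) (u v w : T),
      BT.add (δ (BS.lam a (σ u b)) (BT.mul u v))
          (BT.mul u (BT.add (δ b (BT.inv u)) w)) =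
        BT.mul u (BT.add (δ b v) w)) :
    ∃ B : SkewLeftBrace (S × T),
      (∀ p q : S × T, B.add p q = (BS.add p.1 q.1, BT.add (δ q.1 p.2) q.2)) ∧
      (∀ p q : S × T, B.mul p q = (BS.mul p.1 (σ p.2 q.1), BT.mul p.2 q.2)) := by
  have hσ_one_apply (a : S) : σ BT.one a = a :=
    (hbij BT.one).1 (by rw [← hσhom, BT.mul_one])
  have hσ_map_one (u : T) : σ u BS.one = BS.one :=
    BS.eq_one_of_mul_self (by rw [← hσmul, BS.mul_one])
  have hσ_inv (u : T) (a : S) : σ u (σ (BT.inv u) a) = a := by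
    rw [← hσhom, BT.mul_inv, hσ_one_apply]
  have hδ_zero_apply (u : T) : δ BS.zero u = u :=
    (hδbij BS.zero).1 (by rw [← hδanti, BS.add_zero])
  have hδ_map_zero (a : S) : δ a BT.zero = BT.zero :=
    BT.eq_zero_of_add_self (by rw [← hδadd, BT.add_zero])
  have hδ_neg (a : S) (u : T) : δ a (δ (BS.neg a) u) = u := by
    rw [← hδanti, BS.neg_add, hδ_zero_apply]
  refine ⟨{
    add := fun p q => (BS.add p.1 q.1, BT.add (δ q.1 p.2) q.2)
    zero := (BS.zero, BT.zero)
    neg := fun p => (BS.neg p.1, BT.neg (δ (BS.neg p.1) p.2))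
    mul := fun p q => (BS.mul p.1 (σ p.2 q.1), BT.mul p.2 q.2)
    one := (BS.one, BT.one)
    inv := fun p => (σ (BT.inv p.2) (BS.inv p.1), BT.inv p.2)
    add_assoc := fun p q r => by simp only [hδadd, hδanti, BS.add_assoc, BT.add_assoc]
    zero_add := fun p => by simp only [hδ_map_zero, BS.zero_add, BT.zero_add]
    add_zero := fun p => by simp only [hδ_zero_apply, BS.add_zero, BT.add_zero]
    add_neg := fun p => by simp only [BS.add_neg, BT.add_neg]
    neg_add := fun p => by
      ext
      · exact BS.neg_add p.1
      · dsimp only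
        nth_rewrite 2 [← hδ_neg p.1 p.2]
        rw [← hδadd, BT.neg_add, hδ_map_zero]
    mul_assoc := fun p q r => by simp only [hσmul, hσhom, BS.mul_assoc, BT.mul_assoc]
    one_mul := fun p => by simp only [hσ_one_apply, BS.one_mul, BT.one_mul]
    mul_one := fun p => by simp only [hσ_map_one, BS.mul_one, BT.mul_one]
    mul_inv := fun p => by simp only [hσ_inv, BS.mul_inv, BT.mul_inv]
    inv_mul := fun p => by simp only [← hσmul, BS.inv_mul, BT.inv_mul, hσ_map_one]
    brace := fun p q r => by
      have h := hcomp p.1 r.1 p.2 q.2 r.2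
      rw [SkewLeftBrace.lam] at h
      simp only [hσadd, hσ_inv, h, ← BS.brace] }, fun _ _ => rfl, fun _ _ => rfl⟩
end

section
/- Let S and T be left inverse semi-braces, σ a homomorphism from (T,·) into the automorphism group of the left inverse semi-brace S (write ^u a := σ_u(a)), δ a map assigning to each a ∈ S an additive endomorphism of (T,+) (write u^a := δ(a)(u)), and 𝔟 : S×S → T a δ-cocycle. Suppose that 𝔟(a·(^u b), λ_a(^u c)) + (u·v)^{λ_a(^u c)} + u·(𝔟(^{u⁻¹}(a⁻¹), c) + (u⁻¹)^c) = u·(𝔟(b,c) + v^c) holds for all a,b,c ∈ S and u,v ∈ T. Then S×T, equipped with (a,u)+(b,v) = (a+b, 𝔟(a,b) + u^b + v) and (a,u)·(b,v) = (a·(^u b), u·v), is a left inverse semi-brace (the asymmetric product of S and T via σ, δ and 𝔟). -/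
/-- An idempotent acts trivially under a semigroup action by bijections. -/
theorem action_idem_apply {S T : Type*} (mul : T → T → T) (σ : T → S → S)
    (hbij : ∀ u : T, Function.Bijective (σ u))
    (hσhom : ∀ (u v : T) (a : S), σ (mul u v) a = σ u (σ v a))
    {e : T} (he : mul e e = e) (a : S) : σ e a = a := by
  apply (hbij e).1
  rw [← hσhom, he]

/-- The semidirect product of two inverse semigroups along an action by automorphisms. -/
def InvSemigroup.semidirect {S T : Type*} (A : InvSemigroup S) (B : InvSemigroup T)
    (σ : T → S → S) (hbij : ∀ u : T, Function.Bijective (σ u))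
    (hσmul : ∀ (u : T) (a b : S), σ u (A.mul a b) = A.mul (σ u a) (σ u b))
    (hσhom : ∀ (u v : T) (a : S), σ (B.mul u v) a = σ u (σ v a)) :
    InvSemigroup (S × T) where
  mul p q := (A.mul p.1 (σ p.2 q.1), B.mul p.2 q.2)
  inv p := (σ (B.inv p.2) (A.inv p.1), B.inv p.2)
  mul_assoc p q r := by simp only [hσmul, hσhom, A.mul_assoc, B.mul_assoc]
  mul_inv_mul p := by
    have h (a : S) : σ p.2 (σ (B.inv p.2) a) = a := by
      rw [← hσhom]
      exact action_idem_apply B.mul σ hbij hσhom (by rw [← B.mul_assoc, B.mul_inv_mul]) a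
    simp only [hσhom, h, A.mul_inv_mul, B.mul_inv_mul]
  inv_mul_inv p := by
    have h (a : S) : σ (B.inv p.2) (σ p.2 a) = a := by
      rw [← hσhom]
      exact action_idem_apply B.mul σ hbij hσhom (by rw [← B.mul_assoc, B.inv_mul_inv]) a
    simp only [hσhom, h, ← hσmul, A.inv_mul_inv, B.inv_mul_inv]
  inv_unique p q h₁ h₂ := by
    obtain ⟨a, u⟩ := p
    obtain ⟨x, y⟩ := q
    simp only [Prod.mk.injEq] at h₁ h₂ ⊢
    obtain rfl := B.inv_unique u y h₁.2 h₂.2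
    have h (s : S) : σ u (σ (B.inv u) s) = s := by
      rw [← hσhom]
      exact action_idem_apply B.mul σ hbij hσhom (by rw [← B.mul_assoc, B.mul_inv_mul]) s
    refine ⟨(hbij u).1 ?_, rfl⟩
    rw [h]
    have h₃ := h₁.1
    have h₄ := congrArg (σ u) h₂.1
    simp only [hσhom, hσmul, h] at h₃ h₄
    exact A.inv_unique a (σ u x) h₃ h₄

/-- The asymmetric product of two left inverse semi-braces via `σ`, `δ` and a
`δ`-cocycle `𝔟` is a left inverse semi-brace. -/
theorem stmt_15 {S T : Type*} (BS : LeftInvSemiBrace S) (BT : LeftInvSemiBrace T)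
    (σ : T → S → S)
    (hbij : ∀ u : T, Function.Bijective (σ u))
    (hσadd : ∀ (u : T) (a b : S), σ u (BS.add a b) = BS.add (σ u a) (σ u b))
    (hσmul : ∀ (u : T) (a b : S), σ u (BS.mul a b) = BS.mul (σ u a) (σ u b))
    (hσhom : ∀ (u v : T) (a : S), σ (BT.mul u v) a = σ u (σ v a))
    (δ : S → T → T)
    (hδadd : ∀ (a : S) (u v : T), δ a (BT.add u v) = BT.add (δ a u) (δ a v))
    (𝔟 : S → S → T)
    (hcocycle : ∀ (a b c : S) (u v : T),
      BT.add (BT.add (BT.add (𝔟 (BS.add a b) c) (δ c (𝔟 a b))) (δ c (δ b u))) (δ c v) =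
        BT.add (BT.add (BT.add (𝔟 a (BS.add b c)) (δ (BS.add b c) u)) (𝔟 b c)) (δ c v))
    (hcomp : ∀ (a b c : S) (u v : T),
      BT.add (BT.add (𝔟 (BS.mul a (σ u b)) (BS.lam a (σ u c)))
            (δ (BS.lam a (σ u c)) (BT.mul u v)))
          (BT.mul u (BT.add (𝔟 (σ (BT.inv u) (BS.inv a)) c) (δ c (BT.inv u)))) =
        BT.mul u (BT.add (𝔟 b c) (δ c v))) :
    ∃ B : LeftInvSemiBrace (S × T),
      (∀ p q : S × T, B.add p q =
        (BS.add p.1 q.1, BT.add (BT.add (𝔟 p.1 q.1) (δ q.1 p.2)) q.2)) ∧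
      (∀ p q : S × T, B.mul p q = (BS.mul p.1 (σ p.2 q.1), BT.mul p.2 q.2)) := by
  refine ⟨{ BS.toInvSemigroup.semidirect BT.toInvSemigroup σ hbij hσmul hσhom with
    add := fun p q => (BS.add p.1 q.1, BT.add (BT.add (𝔟 p.1 q.1) (δ q.1 p.2)) q.2)
    add_assoc := ?_
    brace := ?_ }, fun _ _ => rfl, fun _ _ => rfl⟩
  · rintro ⟨a, u⟩ ⟨b, v⟩ ⟨c, w⟩
    refine Prod.ext (BS.add_assoc a b c) ?_
    have h := congrArg (fun t => BT.add t w) (hcocycle a b c u v)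
    simp only [BT.add_assoc, hδadd] at h ⊢
    exact h
  · rintro ⟨a, u⟩ ⟨b, v⟩ ⟨c, w⟩
    have hu (s : S) : σ u (σ (BT.inv u) s) = s := by
      rw [← hσhom]
      exact action_idem_apply BT.mul σ hbij hσhom (by rw [← BT.mul_assoc, BT.mul_inv_mul]) s
    simp only [InvSemigroup.semidirect, hσadd, hu]
    refine Prod.ext (BS.brace a (σ u b) (σ u c)) ?_
    change BT.mul u (BT.add (BT.add (𝔟 b c) (δ c v)) w) =
      BT.add (BT.add (𝔟 (BS.mul a (σ u b)) (BS.lam a (σ u c)))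
          (δ (BS.lam a (σ u c)) (BT.mul u v)))
        (BT.mul u (BT.add (BT.add (𝔟 (σ (BT.inv u) (BS.inv a)) c) (δ c (BT.inv u))) w))
    rw [BT.brace u _ w, BT.brace u (BT.add (𝔟 (σ (BT.inv u) (BS.inv a)) c) _) w,
      ← BT.add_assoc, hcomp]
end

section
/- Let (S,·) be a Clifford semigroup. Then the map r : S×S → S×S defined by r(a,b) = (a·a⁻¹·b, b⁻¹·a·b) is a set-theoretical solution of the Yang-Baxter equation. If, moreover, (S,·) is commutative, then r is cubic, i.e., r∘r∘r = r. -/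
/-- A Clifford semigroup: an inverse semigroup whose idempotents are central. -/
class CliffordSemigroup (S : Type*) extends Semigroup S, Inv S where
  mul_inv_mul_self : ∀ a : S, a * a⁻¹ * a = a
  inv_mul_inv_self : ∀ a : S, a⁻¹ * a * a⁻¹ = a⁻¹
  eq_inv_of_mul : ∀ a x : S, a * x * a = a → x * a * x = x → x = a⁻¹
  idem_comm : ∀ e a : S, e * e = e → e * a = a * e

namespace CliffordSemigroup

variable {S : Type*} [CliffordSemigroup S]

/-- The idempotent `a * a⁻¹` attached to `a`. -/
def idem (a : S) : S := a * a⁻¹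

theorem mul_inv (a : S) : a * a⁻¹ = idem a := rfl

theorem mul_inv_assoc (a x : S) : a * (a⁻¹ * x) = idem a * x := (mul_assoc _ _ _).symm

theorem idem_mul_idem (a : S) : idem a * idem a = idem a := by
  rw [idem, ← mul_assoc, mul_inv_mul_self]

theorem idem_mul_idem_assoc (a x : S) : idem a * (idem a * x) = idem a * x := by
  rw [← mul_assoc, idem_mul_idem]

theorem idem_mul_comm (a x : S) : idem a * x = x * idem a :=
  idem_comm _ _ (idem_mul_idem a)

theorem mul_idem_left_comm (a x y : S) : x * (idem a * y) = idem a * (x * y) := by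
  rw [← mul_assoc, ← idem_mul_comm, mul_assoc]

theorem inv_mul (a : S) : a⁻¹ * a = idem a := by
  have hf : (a⁻¹ * a) * (a⁻¹ * a) = a⁻¹ * a := by
    rw [← mul_assoc, inv_mul_inv_self]
  have h₁ : idem a = (a⁻¹ * a) * idem a := by
    have h := mul_inv_mul_self a
    calc idem a = a * (a⁻¹ * a) * a⁻¹ := by rw [← mul_assoc, h, idem]
      _ = (a⁻¹ * a) * idem a := by rw [← idem_comm _ a hf, idem, mul_assoc _ a]
  have h₂ : a⁻¹ * a = (a⁻¹ * a) * idem a := by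
    rw [mul_assoc, ← idem_mul_comm, idem, mul_inv_mul_self]
  rw [h₂, ← h₁]

theorem inv_mul_assoc (a x : S) : a⁻¹ * (a * x) = idem a * x := by
  rw [← mul_assoc, inv_mul]

theorem idem_mul_self (a : S) : idem a * a = a := mul_inv_mul_self a

theorem idem_mul_self_assoc (a x : S) : idem a * (a * x) = a * x := by
  rw [← mul_assoc, idem_mul_self]

theorem idem_mul_inv (a : S) : idem a * a⁻¹ = a⁻¹ := by
  rw [← inv_mul, inv_mul_inv_self]

theorem mul_inv_rev (a b : S) : (a * b)⁻¹ = b⁻¹ * a⁻¹ := by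
  refine (eq_inv_of_mul _ _ ?_ ?_).symm
  · simp only [mul_assoc, mul_inv_assoc, inv_mul_assoc]
    rw [mul_idem_left_comm b, mul_idem_left_comm a a, idem_mul_self_assoc, ← mul_idem_left_comm,
      idem_mul_self]
  · simp only [mul_assoc, mul_inv_assoc, inv_mul_assoc]
    rw [mul_idem_left_comm a, mul_idem_left_comm b b⁻¹, ← mul_assoc (idem b), idem_mul_inv,
      ← mul_idem_left_comm, idem_mul_inv]

theorem inv_inv (a : S) : a⁻¹⁻¹ = a :=
  (eq_inv_of_mul _ _ (inv_mul_inv_self a) (mul_inv_mul_self a)).symm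

theorem idem_inv (a : S) : idem a⁻¹ = idem a := by
  rw [idem, inv_inv, inv_mul]

theorem idem_mul (a b : S) : idem (a * b) = idem a * idem b := by
  rw [idem, mul_inv_rev, mul_assoc, mul_inv_assoc, mul_idem_left_comm, mul_inv, idem_mul_comm]

theorem inv_idem (a : S) : (idem a)⁻¹ = idem a := by
  rw [idem, mul_inv_rev, inv_inv]

theorem idem_idem (a : S) : idem (idem a) = idem a := by
  rw [idem, inv_idem, idem_mul_idem]

/-- The map `(a, b) ↦ (a * a⁻¹ * b, b⁻¹ * a * b)`. -/
def conjMap (p : S × S) : S × S := (idem p.1 * p.2, p.2⁻¹ * p.1 * p.2)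

theorem isYBE_conjMap : IsYBE (conjMap : S × S → S × S) := by
  funext ⟨a, b, c⟩
  simp only [Function.comp_apply, rOne, rTwo, conjMap, Prod.mk.injEq, mul_inv_rev, inv_inv,
    idem_mul, idem_inv, idem_idem, inv_idem, mul_assoc, mul_inv_assoc]
  refine ⟨?_, ?_, ?_⟩
  · simp only [idem_mul_idem_assoc, mul_idem_left_comm b (idem _)]
  · have hc : idem c * (c⁻¹ * (b * c)) = c⁻¹ * (b * c) := by rw [← mul_assoc, idem_mul_inv]
    simp only [mul_idem_left_comm _ (idem _), mul_idem_left_comm _ b, mul_idem_left_comm _ c⁻¹,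
      idem_mul_idem_assoc, hc]
  · have hb : idem b * (a * (b * c)) = a * (b * c) := by
      rw [← mul_idem_left_comm, idem_mul_self_assoc]
    have hc : idem c * (a * (b * c)) = a * (b * c) := by
      rw [← mul_idem_left_comm, ← mul_idem_left_comm, idem_mul_self]
    simp only [mul_idem_left_comm _ a, hb, hc]

theorem conjMap_cubic (hcomm : ∀ a b : S, a * b = b * a) :
    conjMap ∘ (conjMap ∘ conjMap) = (conjMap : S × S → S × S) := by
  have h : ∀ a b : S, conjMap (a, b) = (idem a * b, idem b * a) := fun a b => by
    simp only [conjMap, mul_assoc, hcomm a b, inv_mul_assoc]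
  funext ⟨a, b⟩
  have h₂ : ∀ a b : S, idem (idem a * b) * (idem b * a) = idem b * a := fun a b => by
    rw [idem_mul, idem_idem, mul_assoc, idem_mul_idem_assoc, mul_idem_left_comm, idem_mul_self]
  simp only [Function.comp_apply, h, h₂]

end CliffordSemigroup

/-- For any Clifford semigroup, the map `r(a,b) = (a·a⁻¹·b, b⁻¹·a·b)` is a solution
of the Yang-Baxter equation; if moreover the semigroup is commutative, then `r` is
cubic, i.e. `r³ = r`. -/
theorem stmt_19 {S : Type*} (M : InvSemigroup S)
    (hclifford : ∀ e a : S, M.mul e e = e → M.mul e a = M.mul a e)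
    (r : S × S → S × S)
    (hr : ∀ a b : S, r (a, b) =
      (M.mul (M.mul a (M.inv a)) b, M.mul (M.mul (M.inv b) a) b)) :
    IsYBE r ∧ ((∀ a b : S, M.mul a b = M.mul b a) → r ∘ (r ∘ r) = r) := by
  let _ : CliffordSemigroup S :=
    { mul := M.mul
      inv := M.inv
      mul_assoc := M.mul_assoc
      mul_inv_mul_self := M.mul_inv_mul
      inv_mul_inv_self := M.inv_mul_inv
      eq_inv_of_mul := M.inv_unique
      idem_comm := hclifford }
  obtain rfl : r = CliffordSemigroup.conjMap := funext fun p => hr p.1 p.2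
  exact ⟨CliffordSemigroup.isYBE_conjMap, CliffordSemigroup.conjMap_cubic⟩
end
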